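/- Let a,b,n,m be nonnegative integers and let λ,μ,ν be partitions with λ ⊆ ((a+b)^n), μ ⊆ ((a+b)^m), and ν ⊆ ((a+b)^{n+m}). Then c^ν_{λ,μ} = c^{ν^{∨[(a+b)^{n+m}]}}_{λ^{∨[(a+b)^n]}, μ^{∨[(a+b)^m]}}. -/

import Mathlib

/-- `f : ℕ → ℕ` is a partition: weakly decreasing and eventually zero
(the parts are `f 0 ≥ f 1 ≥ …`, 0-indexed). -/
def IsPartition (f : ℕ → ℕ) : Prop :=
  (∀ i j, i ≤ j → f j ≤ f i) ∧ ∃ N, ∀ i, N ≤ i → f i = 0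

/-- The cell in row `i`, column `j` (0-indexed) lies in the skew shape `ν/λ`. -/
def InSkew (lam nu : ℕ → ℕ) (i j : ℕ) : Prop :=
  lam i ≤ j ∧ j < nu i

/-- `p` is read weakly before `q` in the row reading word of a (skew) tableau:
right to left along rows, top to bottom. -/
def ReadBefore (p q : ℕ × ℕ) : Prop :=
  p.1 < q.1 ∨ (p.1 = q.1 ∧ q.2 ≤ p.2)

/-- `T` is a Littlewood–Richardson witness for `c^ν_{λ,μ}`: a semistandard skew
tableau of shape `ν/λ` (entries `≥ 1` on the shape, `0` off the shape) with
content `μ`, whose (reverse) row reading word is ballot.  The conditions that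
`λ, μ, ν` are partitions with `λ ⊆ ν` are built in, so that the associated
count vanishes on non-partitions. -/
def IsLRTableau (lam mu nu : ℕ → ℕ) (T : ℕ → ℕ → ℕ) : Prop :=
  IsPartition lam ∧ IsPartition mu ∧ IsPartition nu ∧
  (∀ i, lam i ≤ nu i) ∧
  (∀ i j, ¬ InSkew lam nu i j → T i j = 0) ∧
  (∀ i j, InSkew lam nu i j → 1 ≤ T i j) ∧
  (∀ i j j', InSkew lam nu i j → InSkew lam nu i j' → j ≤ j' → T i j ≤ T i j') ∧
  (∀ i i' j, InSkew lam nu i j → InSkew lam nu i' j → i < i' → T i j < T i' j) ∧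
  (∀ k, {p : ℕ × ℕ | InSkew lam nu p.1 p.2 ∧ T p.1 p.2 = k + 1}.ncard = mu k) ∧
  (∀ k, ∀ q : ℕ × ℕ, InSkew lam nu q.1 q.2 → T q.1 q.2 = k + 2 →
    {p : ℕ × ℕ | InSkew lam nu p.1 p.2 ∧ T p.1 p.2 = k + 2 ∧ ReadBefore p q}.ncard ≤
      {p : ℕ × ℕ | InSkew lam nu p.1 p.2 ∧ T p.1 p.2 = k + 1 ∧ ReadBefore p q}.ncard)

/-- The Littlewood–Richardson coefficient `c^ν_{λ,μ}` (inner shape `λ`,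
content `μ`, outer shape `ν`). -/
noncomputable def lrCoeff (lam mu nu : ℕ → ℕ) : ℕ :=
  Nat.card {T : ℕ → ℕ → ℕ // IsLRTableau lam mu nu T}

/-- The Newell–Littlewood number `N_{λ,μ,ν} = ∑ c^λ_{α,β} c^μ_{β,γ} c^ν_{γ,α}`. -/
noncomputable def NL (lam mu nu : ℕ → ℕ) : ℕ :=
  ∑ᶠ (a : ℕ → ℕ) (b : ℕ → ℕ) (c : ℕ → ℕ),
    lrCoeff a b lam * lrCoeff b c mu * lrCoeff c a nu

/-- Membership in `Par_n`: a partition with at most `n` parts. -/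
def MemParN (n : ℕ) (f : ℕ → ℕ) : Prop :=
  IsPartition f ∧ ∀ i, n ≤ i → f i = 0

/-- `|λ_A| = ∑_{i ∈ A} λ_i` for `A ⊆ [n] = {1,…,n}` (1-indexed subset,
0-indexed parts). -/
def sumParts (f : ℕ → ℕ) (A : Finset ℕ) : ℕ := ∑ i ∈ A, f (i - 1)

/-- `|λ| = ∑ λ_i`. -/
noncomputable def sizeP (f : ℕ → ℕ) : ℕ := ∑ᶠ i, f i

/-- The complement `λ^{∨[c^ℓ]}` of a partition `λ ⊆ (c^ℓ)`
(rectangle with `c` columns and `ℓ` rows). -/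
def compP (c l : ℕ) (f : ℕ → ℕ) : ℕ → ℕ := fun k =>
  if k < l then c - f (l - 1 - k) else 0

/-! ### Chains of interlacing partitions -/

def Ch (m : ℕ) (lam nu : ℕ → ℕ) (x : ℕ → ℕ → ℕ) : Prop :=
  x 0 = lam ∧ (∀ k, m ≤ k → x k = nu) ∧
    ∀ k i, x k i ≤ x (k+1) i ∧ x (k+1) (i+1) ≤ x k i

def RR (x : ℕ → ℕ → ℕ) (k i : ℕ) : ℤ :=
  ∑ r ∈ Finset.range i, ((x (k+1) r : ℤ) - x k r)

lemma RR_succ (x : ℕ → ℕ → ℕ) (k i : ℕ) :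
    RR x k (i+1) = RR x k i + ((x (k+1) i : ℤ) - x k i) := by
  rw [RR, Finset.sum_range_succ, ← RR]

lemma RR_zero (x : ℕ → ℕ → ℕ) (k : ℕ) : RR x k 0 = 0 := by simp [RR]

lemma Ch.RR_mono {m lam nu x} (h : Ch m lam nu x) (k : ℕ) {i j : ℕ} (hij : i ≤ j) :
    RR x k i ≤ RR x k j := by
  induction j, hij using Nat.le_induction with
  | base => exact le_rfl
  | succ j _ ih =>
    rw [RR_succ]
    have := (h.2.2 k j).1
    omega

def tog (x : ℕ → ℕ → ℕ) (k i j : ℕ) : ℕ → ℕ → ℕ := fun l r =>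
  if l = k + 1 then
    if r < i then x l r
    else if r = i then j + max (x k r) (x (k+2) (r+1)) - x (k+1) r
    else min (x (k+2) r) (x k (r-1)) + max (x k r) (x (k+2) (r+1)) - x (k+1) r
  else x l r

lemma tog_ne (x : ℕ → ℕ → ℕ) (k i j : ℕ) {l : ℕ} (hl : l ≠ k+1) : tog x k i j l = x l := by
  funext r; simp [tog, hl]

lemma tog_lt (x : ℕ → ℕ → ℕ) (k i j : ℕ) {l r : ℕ} (hr : r < i) : tog x k i j l r = x l r := by
  simp [tog, hr]

lemma tog_eq (x : ℕ → ℕ → ℕ) (k i j : ℕ) :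
    tog x k i j (k+1) i = j + max (x k i) (x (k+2) (i+1)) - x (k+1) i := by
  simp [tog]

lemma tog_gt (x : ℕ → ℕ → ℕ) (k i j : ℕ) {r : ℕ} (hr : i < r) :
    tog x k i j (k+1) r =
      min (x (k+2) r) (x k (r-1)) + max (x k r) (x (k+2) (r+1)) - x (k+1) r := by
  have h1 : ¬ r < i := by omega
  have h2 : r ≠ i := by omega
  simp [tog, h1, h2]

lemma tog_ch {m lam nu x} (h : Ch m lam nu x) {k i j : ℕ} (hk : k + 1 < m)
    (h1 : x (k+1) i ≤ j) (h2 : j ≤ x (k+2) i) (h3 : ∀ i', i = i' + 1 → j ≤ x k i') :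
    Ch m lam nu (tog x k i j) := by
  obtain ⟨a, b, c⟩ := h
  have c' : ∀ k i, x (k+1) i ≤ x (k+2) i ∧ x (k+2) (i+1) ≤ x (k+1) i := fun k i => c (k+1) i
  refine ⟨?_, ?_, ?_⟩
  · rw [tog_ne _ _ _ _ (by omega)]; exact a
  · intro l hl
    rw [tog_ne _ _ _ _ (by omega)]; exact b l hl
  · intro l r
    by_cases hl : l = k
    · subst hl
      rw [tog_ne x l i j (l := l) (by omega)]
      have e1 := c l r
      have e2 := c' l r
      have e3 := c l (r+1)
      have e4 := c' l (r+1)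
      constructor
      · rcases lt_trichotomy r i with hr | hr | hr
        · rw [tog_lt _ _ _ _ hr]; omega
        · subst hr; rw [tog_eq]; omega
        · rw [tog_gt _ _ _ _ hr]
          obtain ⟨r', rfl⟩ : ∃ r', r = r' + 1 := ⟨r - 1, by omega⟩
          have := c l r'
          simp only [Nat.add_sub_cancel]
          have := c' l r'
          omega
      · rcases lt_trichotomy (r+1) i with hr | hr | hr
        · rw [tog_lt _ _ _ _ hr]; omega
        · subst hr; rw [tog_eq]
          have := h3 r rfl
          omega
        · rw [tog_gt _ _ _ _ hr]
          simp only [Nat.add_sub_cancel]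
          omega
    · by_cases hl2 : l = k + 1
      · subst hl2
        rw [tog_ne x k i j (l := k+1+1) (by omega), show k+1+1 = k+2 from rfl]
        have e1 := c k r
        have e2 := c' k r
        have e3 := c k (r+1)
        have e4 := c' k (r+1)
        rcases lt_trichotomy r i with hr | hr | hr
        · rw [tog_lt _ _ _ _ hr]; omega
        · subst hr; rw [tog_eq]; omega
        · rw [tog_gt _ _ _ _ hr]
          obtain ⟨r', rfl⟩ : ∃ r', r = r' + 1 := ⟨r - 1, by omega⟩
          have := c k r'
          simp only [Nat.add_sub_cancel]
          have := c' k r'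
          omega
      · rw [tog_ne _ _ _ _ hl2, tog_ne _ _ _ _ (by omega)]
        exact c l r

lemma tog_tog {m lam nu x} (h : Ch m lam nu x) {k i j : ℕ}
    (h1 : x (k+1) i ≤ j) :
    tog (tog x k i j) k i j = x := by
  obtain ⟨a, b, c⟩ := h
  have c' : ∀ k i, x (k+1) i ≤ x (k+2) i ∧ x (k+2) (i+1) ≤ x (k+1) i := fun k i => c (k+1) i
  funext l r
  by_cases hl : l = k + 1
  · subst hl
    have e1 := c k r
    have e2 := c' k r
    have e3 := c k (r+1)
    have e4 := c' k (r+1)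
    have n1 := tog_ne x k i j (l := k) (by omega)
    have n2 := tog_ne x k i j (l := k+2) (by omega)
    rcases lt_trichotomy r i with hr | hr | hr
    · rw [tog_lt _ _ _ _ hr, tog_lt _ _ _ _ hr]
    · subst hr; rw [tog_eq, tog_eq, n1, n2]; omega
    · rw [tog_gt _ _ _ _ hr, tog_gt _ _ _ _ hr, n1, n2]
      obtain ⟨r', rfl⟩ : ∃ r', r = r' + 1 := ⟨r - 1, by omega⟩
      have := c k r'
      have := c' k r'
      simp only [Nat.add_sub_cancel]
      omega
  · rw [tog_ne _ _ _ _ hl, tog_ne _ _ _ _ hl]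

lemma tog_sum_aux {m lam nu x} (h : Ch m lam nu x) {k i j : ℕ}
    (h1 : x (k+1) i ≤ j) (M : ℕ) (hM : i ≤ M) :
    RR (tog x k i j) k (M+1) + min (x (k+2) (M+1) : ℤ) (x k M) =
      RR x (k+1) (M+1) + RR x k i - RR x (k+1) i + j - x (k+2) i + x (k+2) (M+1) := by
  obtain ⟨a, b, c⟩ := h
  have c' : ∀ k i, x (k+1) i ≤ x (k+2) i ∧ x (k+2) (i+1) ≤ x (k+1) i := fun k i => c (k+1) i
  have n1 := tog_ne x k i j (l := k) (by omega)
  induction M, hM using Nat.le_induction with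
  | base =>
    have hR : RR (tog x k i j) k i = RR x k i := by
      unfold RR
      refine Finset.sum_congr rfl fun r hr => ?_
      rw [tog_lt _ _ _ _ (Finset.mem_range.1 hr), tog_lt _ _ _ _ (Finset.mem_range.1 hr)]
    rw [RR_succ, hR, RR_succ, n1, tog_eq, show k+1+1 = k+2 from rfl]
    have e1 := c k i
    have e2 := c' k i
    have e3 := c k (i+1)
    have e4 := c' k (i+1)
    omega
  | succ M hM ih =>
    rw [RR_succ _ _ (M+1), RR_succ _ _ (M+1), n1, tog_gt _ _ _ _ (by omega : i < M+1),
      show k+1+1 = k+2 from rfl]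
    have e1 := c k (M+1)
    have e2 := c' k (M+1)
    have e3 := c k (M+2)
    have e4 := c' k (M+2)
    have e5 := c k M
    have e6 := c' k M
    simp only [show M + 1 + 1 = M + 2 from rfl, Nat.add_sub_cancel] at *
    omega

lemma tog_wt {m lam nu x} (h : Ch m lam nu x) {k i j N : ℕ}
    (h1 : x (k+1) i ≤ j) (hN : i < N) (hz : x (k+2) N = 0) :
    RR (tog x k i j) k N = RR x (k+1) N + (RR x k i - RR x (k+1) i + j - x (k+2) i) := by
  obtain ⟨M, rfl⟩ : ∃ M, N = M + 1 := ⟨N - 1, by omega⟩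
  have := tog_sum_aux h h1 M (by omega)
  rw [hz] at this
  simp at this
  linarith

lemma RR_add (x : ℕ → ℕ → ℕ) (k N : ℕ) :
    RR x k N + RR x (k+1) N = ∑ r ∈ Finset.range N, ((x (k+2) r : ℤ) - x k r) := by
  unfold RR
  rw [← Finset.sum_add_distrib]
  refine Finset.sum_congr rfl fun r _ => ?_
  ring_nf

lemma tog_wt' {m lam nu x} (h : Ch m lam nu x) {k i j N : ℕ}
    (h1 : x (k+1) i ≤ j) (hN : i < N) (hz : x (k+2) N = 0) :
    RR (tog x k i j) (k+1) N = RR x k N - (RR x k i - RR x (k+1) i + j - x (k+2) i) := by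
  have a := RR_add (tog x k i j) k N
  have b := RR_add x k N
  rw [tog_ne _ _ _ _ (by omega), tog_ne _ _ _ _ (by omega), ← b, tog_wt h h1 hN hz] at a
  linarith

lemma tog_wt_ne (x : ℕ → ℕ → ℕ) {k i j N l : ℕ} (h1 : l ≠ k) (h2 : l ≠ k + 1) :
    RR (tog x k i j) l N = RR x l N := by
  unfold RR
  rw [tog_ne _ _ _ _ (by omega), tog_ne _ _ _ _ (by omega)]

lemma tog_RR_lt (x : ℕ → ℕ → ℕ) {k i j l s : ℕ} (hs : s ≤ i) :
    RR (tog x k i j) l s = RR x l s := by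
  unfold RR
  refine Finset.sum_congr rfl fun r hr => ?_
  have := Finset.mem_range.1 hr
  rw [tog_lt _ _ _ _ (by omega), tog_lt _ _ _ _ (by omega)]

/-! ### Violations -/

def Viol (x : ℕ → ℕ → ℕ) (k i : ℕ) : Prop := RR x k i < RR x (k+1) (i+1)

def Good (x : ℕ → ℕ → ℕ) : Prop := ∀ k i, ¬ Viol x k i

def First (x : ℕ → ℕ → ℕ) (p : ℕ × ℕ) : Prop :=
  Viol x p.1 p.2 ∧ (∀ i' < p.2, ∀ k', ¬ Viol x k' i') ∧ ∀ k' > p.1, ¬ Viol x k' p.2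

lemma First.unique {x p q} (hp : First x p) (hq : First x q) : p = q := by
  obtain ⟨k, i⟩ := p
  obtain ⟨k', i'⟩ := q
  obtain ⟨a, b, c⟩ := hp
  obtain ⟨a', b', c'⟩ := hq
  simp only at *
  have hi : i = i' := by
    rcases lt_trichotomy i i' with h | h | h
    · exact absurd a (b' _ h _)
    · exact h
    · exact absurd a' (b _ h _)
  subst hi
  have hk : k = k' := by
    rcases lt_trichotomy k k' with h | h | h
    · exact absurd a' (c _ h)
    · exact h
    · exact absurd a (c' _ h)
  rw [hk]

lemma viol_lt {m lam nu x} (h : Ch m lam nu x) {k i : ℕ} (hv : Viol x k i) : k + 1 < m := by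
  by_contra hc
  have h0 : RR x (k+1) (i+1) = 0 := by
    unfold RR
    rw [h.2.1 (k+1) (by omega), h.2.1 (k+1+1) (by omega)]; simp
  have := h.RR_mono k (Nat.zero_le i)
  rw [RR_zero] at this
  unfold Viol at hv
  omega

lemma exists_first {m lam nu x} (h : Ch m lam nu x) (hb : ¬ Good x) : ∃ p, First x p := by
  classical
  unfold Good at hb
  push Not at hb
  have hb' : ∃ i k, Viol x k i := by obtain ⟨k, i, hh⟩ := hb; exact ⟨i, k, hh⟩
  obtain ⟨k0, hk0⟩ := Nat.find_spec hb'
  refine ⟨(Nat.findGreatest (fun k => Viol x k (Nat.find hb')) m, Nat.find hb'), ?_, ?_, ?_⟩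
  · exact Nat.findGreatest_spec (P := fun k => Viol x k (Nat.find hb')) (m := k0)
      (by have := viol_lt h hk0; omega) hk0
  · intro i' hi' k' hv
    exact Nat.find_min hb' hi' ⟨k', hv⟩
  · intro k' hk' hv
    have := viol_lt h hv
    exact Nat.findGreatest_is_greatest hk' (by omega) hv

def cutJ (x : ℕ → ℕ → ℕ) (k i : ℕ) : ℕ :=
  ((x (k+2) i : ℤ) - (RR x k i + 1 - RR x (k+1) i)).toNat

lemma cut_props {m lam nu x} (h : Ch m lam nu x) {k i : ℕ} (hf : First x (k, i)) :
    (cutJ x k i : ℤ) = (x (k+2) i : ℤ) - (RR x k i + 1 - RR x (k+1) i) ∧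
    x (k+1) i ≤ cutJ x k i ∧ cutJ x k i < x (k+2) i ∧
    ∀ i', i = i' + 1 → cutJ x k i ≤ x k i' := by
  obtain ⟨a, b, _⟩ := hf
  simp only [Viol] at a b
  have e1 := RR_succ x (k+1) i
  simp only [show k + 1 + 1 = k + 2 from rfl] at *
  have key : (cutJ x k i : ℤ) = (x (k+2) i : ℤ) - (RR x k i + 1 - RR x (k+1) i) := by
    unfold cutJ
    rw [Int.toNat_of_nonneg]
    omega
  refine ⟨key, by omega, ?_, ?_⟩
  · cases i with
    | zero => rw [RR_zero, RR_zero] at *; omega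
    | succ i =>
      have := b i (by omega) k
      have := h.RR_mono k (Nat.le_succ i)
      simp only [Nat.succ_eq_add_one] at *
      omega
  · rintro i' rfl
    have e := b i' (by omega) k
    have e2 := RR_succ x k i'
    have := h.2.2 (k+1) i'
    simp only [show k + 1 + 1 = k + 2 from rfl] at *
    omega

lemma first_tog {m lam nu x} (h : Ch m lam nu x) {k i : ℕ} (hf : First x (k, i)) :
    First (tog x k i (cutJ x k i)) (k, i) ∧
    cutJ (tog x k i (cutJ x k i)) k i = cutJ x k i := by
  obtain ⟨c1, c2, c3, c4⟩ := cut_props h hf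
  have hch := tog_ch h (viol_lt h hf.1) c2 c3.le c4
  obtain ⟨a, b, c⟩ := hf
  set j := cutJ x k i with hj
  have f1 : tog x k i j (k+2) = x (k+2) := tog_ne _ _ _ _ (by omega)
  refine ⟨⟨?_, ?_, ?_⟩, ?_⟩
  · simp only [Viol] at *
    rw [RR_succ, tog_RR_lt _ le_rfl, tog_RR_lt _ le_rfl, tog_eq,
      show k + 1 + 1 = k + 2 from rfl, f1]
    have := h.2.2 k i
    have := h.2.2 (k+1) i
    simp only [show k + 1 + 1 = k + 2 from rfl] at *
    omega
  · intro i' hi' k'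
    have := b i' hi' k'
    simp only [Viol] at *
    rwa [tog_RR_lt _ hi'.le, tog_RR_lt _ hi']
  · intro k' hk'
    have := c k' hk'
    simp only [Viol] at *
    rwa [tog_RR_lt _ le_rfl, tog_wt_ne _ (by omega) (by omega)]
  · rw [cutJ, f1, tog_RR_lt _ le_rfl, tog_RR_lt _ le_rfl]
    rfl

lemma Ch.mono {m lam nu x} (h : Ch m lam nu x) {k l : ℕ} (hkl : k ≤ l) (i : ℕ) :
    x k i ≤ x l i := by
  induction l, hkl using Nat.le_induction with
  | base => exact le_rfl
  | succ l _ ih => exact ih.trans (h.2.2 l i).1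

lemma Ch.le_nu {m lam nu x} (h : Ch m lam nu x) (k i : ℕ) : x k i ≤ nu i := by
  have := h.mono (le_max_left k m) i
  rwa [h.2.1 _ (le_max_right k m)] at this

lemma Ch.lam_le {m lam nu x} (h : Ch m lam nu x) (k i : ℕ) : lam i ≤ x k i := by
  have := h.mono (Nat.zero_le k) i
  rwa [h.1] at this

lemma ch_finite (m : ℕ) {lam nu : ℕ → ℕ} (hnu : IsPartition nu) :
    Finite {x // Ch m lam nu x} := by
  obtain ⟨h1, N, h2⟩ := hnu
  let f : {x // Ch m lam nu x} → (Fin m → Fin N → Fin (nu 0 + 1)) := fun x k i =>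
    ⟨x.1 k i, by have := x.2.le_nu k i; have := h1 0 i (Nat.zero_le _); omega⟩
  refine Finite.of_injective f ?_
  rintro ⟨x, hx⟩ ⟨y, hy⟩ hxy
  apply Subtype.ext
  funext k i
  by_cases hk : k < m
  · by_cases hi : i < N
    · have := congrFun (congrFun hxy ⟨k, hk⟩) ⟨i, hi⟩
      simpa [f] using this
    · have a := hx.le_nu k i
      have b := hy.le_nu k i
      have := h2 i (by omega)
      simp only; omega
  · simp only
    rw [hx.2.1 k (by omega), hy.2.1 k (by omega)]

/-! ### Signed counting -/

open Equiv in
noncomputable def sg {m : ℕ} (v u : Fin m → ℤ) : ℤ :=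
  ∑ w : Perm (Fin m), ((Perm.sign w : ℤˣ) : ℤ) * if v ∘ w = u then 1 else 0

open Equiv in
lemma sg_swap {m : ℕ} (v u : Fin m → ℤ) {a b : Fin m} (hab : a ≠ b) :
    sg (v ∘ swap a b) u = - sg v u := by
  unfold sg
  rw [← Equiv.sum_comp (Equiv.mulLeft (swap a b)), ← Finset.sum_neg_distrib]
  refine Finset.sum_congr rfl fun w _ => ?_
  have : (v ∘ swap a b) ∘ (swap a b * w : Perm (Fin m)) = v ∘ w := by
    funext t; simp
  simp only [Equiv.coe_mulLeft, Perm.sign_mul, Perm.sign_swap hab, this]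
  split_ifs <;> simp

open Equiv in
lemma sg_anti {m : ℕ} {v u : Fin m → ℤ} (hv : StrictAnti v) (hu : StrictAnti u) :
    sg v u = if v = u then 1 else 0 := by
  unfold sg
  rw [Finset.sum_eq_single 1]
  · simp
  · intro w _ hw
    rw [if_neg, mul_zero]
    rintro rfl
    apply hw
    have hm : StrictMono w := by
      intro s t hst
      have := hu hst
      exact hv.lt_iff_gt.1 this
    have : ∀ e : Fin m ≃o Fin m, e = OrderIso.refl _ := fun e => Subsingleton.elim _ _
    have h2 := this (hm.orderIsoOfSurjective w w.surjective)
    ext t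
    have := congrArg (fun e => ((e t : Fin m) : ℕ)) h2
    simpa using this
  · simp

noncomputable def flipC (x : ℕ → ℕ → ℕ) : ℕ → ℕ → ℕ :=
  open Classical in
  if h : ∃ p, First x p then
    tog x h.choose.1 h.choose.2 (cutJ x h.choose.1 h.choose.2) else x

lemma flipC_eq {x : ℕ → ℕ → ℕ} {k i : ℕ} (hf : First x (k, i)) :
    flipC x = tog x k i (cutJ x k i) := by
  have h : ∃ p, First x p := ⟨_, hf⟩
  have e : h.choose = (k, i) := h.choose_spec.unique hf
  unfold flipC
  rw [dif_pos h, e]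

lemma good_not_first {x : ℕ → ℕ → ℕ} {p : ℕ × ℕ} (hf : First x p) : ¬ Good x :=
  fun h => h _ _ hf.1

def wtv (m N : ℕ) (x : ℕ → ℕ → ℕ) : Fin m → ℤ := fun k => RR x k N

def rhov (m : ℕ) : Fin m → ℤ := fun k => -(k : ℤ)

open Equiv in
lemma tog_wtv {m N : ℕ} {lam nu x} (h : Ch m lam nu x) {k i j : ℕ} (hk : k + 1 < m)
    (h1 : x (k+1) i ≤ j) (hN : i < N) (hz : x (k+2) N = 0) (d : ℤ)
    (hd : RR x k i - RR x (k+1) i + j - x (k+2) i = -d) :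
    (wtv m N (tog x k i j) + d • rhov m) =
      (wtv m N x + d • rhov m) ∘ swap ⟨k, by omega⟩ ⟨k+1, hk⟩ := by
  funext l
  have a := tog_wt h h1 hN hz
  have b := tog_wt' h h1 hN hz
  rw [hd] at a b
  simp only [Function.comp, Pi.add_apply, Pi.smul_apply, wtv, rhov, smul_eq_mul]
  by_cases hl : l = ⟨k, by omega⟩
  · subst hl
    rw [swap_apply_left, a]
    push_cast; ring
  · by_cases hl2 : l = ⟨k+1, hk⟩
    · subst hl2
      rw [swap_apply_right, b]
      push_cast; ring
    · rw [swap_apply_of_ne_of_ne hl hl2, tog_wt_ne]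
      · intro h; exact hl (Fin.ext h)
      · intro h; exact hl2 (Fin.ext h)

lemma flip_props {m N : ℕ} {lam nu x} (hN : ∀ i, N ≤ i → nu i = 0)
    (h : Ch m lam nu x) (hb : ¬ Good x) :
    Ch m lam nu (flipC x) ∧ ¬ Good (flipC x) ∧ flipC (flipC x) = x ∧
    ∀ u, sg (wtv m N x + rhov m) u + sg (wtv m N (flipC x) + rhov m) u = 0 := by
  obtain ⟨⟨k, i⟩, hf⟩ := exists_first h hb
  obtain ⟨c1, c2, c3, c4⟩ := cut_props h hf
  have hk : k + 1 < m := viol_lt h hf.1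
  obtain ⟨f1, f2⟩ := first_tog h hf
  rw [flipC_eq hf]
  refine ⟨tog_ch h hk c2 c3.le c4, good_not_first f1, ?_, ?_⟩
  · rw [flipC_eq f1, f2, tog_tog h c2]
  · intro u
    have hiN : i < N := by
      by_contra hc
      have := hN i (by omega)
      have := h.le_nu (k+2) i
      omega
    have hz : x (k+2) N = 0 := by
      have := h.le_nu (k+2) N
      have := hN N le_rfl
      omega
    have := tog_wtv h hk c2 hiN hz 1 (by linarith)
    rw [one_smul] at this
    rw [this, sg_swap]
    · ring
    · intro h; simp at h

lemma good_anti {m N : ℕ} {lam nu x} (h : Ch m lam nu x) (hg : Good x) :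
    StrictAnti (wtv m N x + rhov m) := by
  have key : ∀ k l, k ≤ l → RR x l N ≤ RR x k N := by
    intro k l hkl
    induction l, hkl using Nat.le_induction with
    | base => exact le_rfl
    | succ l _ ih =>
      refine le_trans ?_ ih
      have := hg l N
      unfold Viol at this
      have := h.RR_mono (l+1) (Nat.le_succ N)
      simp only [Nat.succ_eq_add_one] at this
      omega
  intro s t hst
  simp only [Pi.add_apply, wtv, rhov]
  have h1 := key s t (le_of_lt hst)
  have h2 : (s : ℕ) < t := hst
  omega

lemma mu_anti {m : ℕ} {mu : ℕ → ℕ} (hmu : IsPartition mu) :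
    StrictAnti ((fun k : Fin m => (mu k : ℤ)) + rhov m) := by
  intro s t hst
  simp only [Pi.add_apply, rhov]
  have h2 : (s : ℕ) < t := hst
  have := hmu.1 s t h2.le
  omega

def LRC (m N : ℕ) (lam mu nu : ℕ → ℕ) (x : ℕ → ℕ → ℕ) : Prop :=
  Ch m lam nu x ∧ Good x ∧ wtv m N x = fun k : Fin m => (mu k : ℤ)

open Classical in
lemma stem {m N : ℕ} {lam mu nu : ℕ → ℕ} [Fintype {x // Ch m lam nu x}]
    (hN : ∀ i, N ≤ i → nu i = 0) (hmu : IsPartition mu) :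
    (Nat.card {x // LRC m N lam mu nu x} : ℤ) =
      ∑ x : {x // Ch m lam nu x},
        sg (wtv m N x.1 + rhov m) ((fun k : Fin m => (mu k : ℤ)) + rhov m) := by
  rw [← Finset.sum_filter_add_sum_filter_not Finset.univ
    (fun x : {x // Ch m lam nu x} => Good x.1)]
  have hbad : ∑ x : {x // Ch m lam nu x} with ¬ Good x.1,
        sg (wtv m N x.1 + rhov m) ((fun k : Fin m => (mu k : ℤ)) + rhov m) = 0 := by
    refine Finset.sum_involution
      (fun x hx => ⟨flipC x.1, (flip_props hN x.2 (Finset.mem_filter.1 hx).2).1⟩) ?_ ?_ ?_ ?_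
    · intro x hx
      exact (flip_props hN x.2 (Finset.mem_filter.1 hx).2).2.2.2 _
    · intro x hx h0 he
      have := (flip_props hN x.2 (Finset.mem_filter.1 hx).2).2.2.2
        ((fun k : Fin m => (mu k : ℤ)) + rhov m)
      rw [show flipC x.1 = x.1 from congrArg Subtype.val he] at this
      omega
    · intro x hx
      exact Finset.mem_filter.2 ⟨Finset.mem_univ _,
        (flip_props hN x.2 (Finset.mem_filter.1 hx).2).2.1⟩
    · intro x hx
      exact Subtype.ext (flip_props hN x.2 (Finset.mem_filter.1 hx).2).2.2.1
  rw [hbad, add_zero]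
  have : ∀ x ∈ (Finset.univ.filter fun x : {x // Ch m lam nu x} => Good x.1),
      sg (wtv m N x.1 + rhov m) ((fun k : Fin m => (mu k : ℤ)) + rhov m) =
      if wtv m N x.1 = (fun k : Fin m => (mu k : ℤ)) then 1 else 0 := by
    intro x hx
    rw [sg_anti (good_anti x.2 (Finset.mem_filter.1 hx).2) (mu_anti hmu)]
    simp
  rw [Finset.sum_congr rfl this, Finset.sum_boole, Finset.filter_filter]
  norm_cast
  rw [← Fintype.card_subtype, ← Nat.card_eq_fintype_card]
  refine Nat.card_congr ⟨fun x => ⟨⟨x.1, x.2.1⟩, x.2.2⟩, fun x => ⟨x.1.1, x.1.2, x.2⟩, ?_, ?_⟩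
  · intro x; rfl
  · intro x; rfl

open Equiv in
lemma sum_symm_swap {m N : ℕ} {lam nu : ℕ → ℕ} [Fintype {x // Ch m lam nu x}]
    (hN : ∀ i, N ≤ i → nu i = 0) (hN0 : 0 < N) (F : (Fin m → ℤ) → ℤ) {k : ℕ} (hk : k + 1 < m) :
    ∑ x : {x // Ch m lam nu x}, F (wtv m N x.1 ∘ swap ⟨k, by omega⟩ ⟨k+1, hk⟩) =
      ∑ x : {x // Ch m lam nu x}, F (wtv m N x.1) := by
  have hch : ∀ x, Ch m lam nu x → Ch m lam nu (tog x k 0 (x (k+2) 0)) := fun x hx =>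
    tog_ch hx hk (hx.2.2 (k+1) 0).1 le_rfl (by intro i' h; omega)
  have hinv : ∀ x, Ch m lam nu x →
      tog (tog x k 0 (x (k+2) 0)) k 0 (tog x k 0 (x (k+2) 0) (k+2) 0) = x := by
    intro x hx
    rw [tog_ne x _ _ _ (l := k+2) (by omega)]
    exact tog_tog hx (hx.2.2 (k+1) 0).1
  refine Finset.sum_bij' (fun x _ => ⟨tog x.1 k 0 (x.1 (k+2) 0), hch x.1 x.2⟩)
    (fun x _ => ⟨tog x.1 k 0 (x.1 (k+2) 0), hch x.1 x.2⟩) ?_ ?_ ?_ ?_ ?_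
  · simp
  · simp
  · intro x _; exact Subtype.ext (hinv x.1 x.2)
  · intro x _; exact Subtype.ext (hinv x.1 x.2)
  · intro x _
    have hz : x.1 (k+2) N = 0 := by
      have := x.2.le_nu (k+2) N
      have := hN N le_rfl
      omega
    have := tog_wtv x.2 hk (x.2.2.2 (k+1) 0).1 hN0 hz 0 (by simp [RR_zero])
    simp only [zero_smul, add_zero] at this
    rw [this]

open Equiv in
lemma sum_symm {m N : ℕ} {lam nu : ℕ → ℕ} [Fintype {x // Ch m lam nu x}]
    (hN : ∀ i, N ≤ i → nu i = 0) (hmN : m ≤ N) (σ : Perm (Fin m)) (F : (Fin m → ℤ) → ℤ) :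
    ∑ x : {x // Ch m lam nu x}, F (wtv m N x.1 ∘ σ) =
      ∑ x : {x // Ch m lam nu x}, F (wtv m N x.1) := by
  cases m with
  | zero =>
    refine Finset.sum_congr rfl fun x _ => ?_
    congr 1
    exact Subsingleton.elim _ _
  | succ m =>
    have hσ : σ ∈ Submonoid.closure (Set.range fun i : Fin m ↦ swap i.castSucc i.succ) := by
      rw [Perm.mclosure_swap_castSucc_succ]; trivial
    induction hσ using Submonoid.closure_induction generalizing F with
    | mem y hy =>
      obtain ⟨i, rfl⟩ := hy
      exact sum_symm_swap hN (by omega) F (k := i) (by omega)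
    | one => simp
    | mul a b _ _ iha ihb =>
      have := iha (fun v => F (v ∘ b))
      rw [ihb F] at this
      rw [← this]
      rfl

/-! ### Complementation -/

def compC (c n m : ℕ) (x : ℕ → ℕ → ℕ) : ℕ → ℕ → ℕ := fun k => compP c (n + min k m) (x k)

lemma Ch.supp {m n lam nu x} (h : Ch m lam nu x) (hl : ∀ i, n ≤ i → lam i = 0) (k : ℕ) :
    ∀ i, n + min k m ≤ i → x k i = 0 := by
  have key : ∀ k i, n + k ≤ i → x k i = 0 := by
    intro k
    induction k with
    | zero => intro i hi; rw [h.1]; exact hl i hi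
    | succ k ih =>
      intro i hi
      obtain ⟨i', rfl⟩ : ∃ i', i = i' + 1 := ⟨i - 1, by omega⟩
      have := (h.2.2 k i').2
      have := ih i' (by omega)
      omega
  intro i hi
  by_cases hk : k ≤ m
  · exact key k i (by omega)
  · have := h.2.1 k (by omega)
    rw [this, ← h.2.1 m le_rfl]
    exact key m i (by omega)

lemma compC_ch {c m n lam nu x} (h : Ch m lam nu x) :
    Ch m (compP c n lam) (compP c (n+m) nu) (compC c n m x) := by
  refine ⟨?_, ?_, ?_⟩
  · simp [compC, h.1]
  · intro k hk
    simp only [compC]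
    rw [h.2.1 k hk, min_eq_right hk]
  · intro k i
    simp only [compC, compP]
    by_cases hk : k < m
    · rw [min_eq_left hk.le, min_eq_left (by omega : k+1 ≤ m)]
      constructor
      · by_cases hi : i < n + k
        · rw [if_pos hi, if_pos (by omega)]
          have := (h.2.2 k (n+k-1-i)).2
          rw [show n + (k+1) - 1 - i = n + k - 1 - i + 1 by omega]
          omega
        · rw [if_neg hi]; omega
      · by_cases hi : i < n + k
        · rw [if_pos hi, if_pos (by omega)]
          have := (h.2.2 k (n+k-1-i)).1
          rw [show n + (k+1) - 1 - (i+1) = n + k - 1 - i by omega]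
          omega
        · rw [if_neg (by omega)]; omega
    · rw [min_eq_right (by omega), min_eq_right (by omega), h.2.1 k (by omega),
        h.2.1 (k+1) (by omega)]
      refine ⟨le_rfl, ?_⟩
      by_cases hi : i + 1 < n + m
      · rw [if_pos hi, if_pos (by omega)]
        have h1 := (h.2.2 m (n+m-1-(i+1))).1
        have h2 := (h.2.2 m (n+m-1-(i+1))).2
        rw [h.2.1 m le_rfl, h.2.1 (m+1) (by omega)] at h2
        rw [show n + m - 1 - i = n + m - 1 - (i+1) + 1 by omega]
        omega
      · rw [if_neg hi]; omega

lemma compP_compP {c l : ℕ} {f : ℕ → ℕ} (h : ∀ i, l ≤ i → f i = 0) (hc : ∀ i, f i ≤ c) :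
    compP c l (compP c l f) = f := by
  funext i
  simp only [compP]
  by_cases hi : i < l
  · rw [if_pos hi, if_pos (by omega), show l - 1 - (l - 1 - i) = i by omega]
    have := hc i
    omega
  · rw [if_neg hi, h i (by omega)]

lemma compC_compC {c m n lam nu x} (h : Ch m lam nu x) (hl : ∀ i, n ≤ i → lam i = 0)
    (hc : ∀ i, nu i ≤ c) : compC c n m (compC c n m x) = x := by
  funext k
  simp only [compC]
  exact compP_compP (h.supp hl k) (fun i => (h.le_nu k i).trans (hc i))

lemma sum_compP {c l N : ℕ} {f : ℕ → ℕ} (h : ∀ i, l ≤ i → f i = 0) (hc : ∀ i, f i ≤ c)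
    (hlN : l ≤ N) :
    ∑ i ∈ Finset.range N, (compP c l f i : ℤ) = c * l - ∑ i ∈ Finset.range N, (f i : ℤ) := by
  have e : ∀ g : ℕ → ℕ, (∀ i, l ≤ i → g i = 0) →
      ∑ i ∈ Finset.range N, (g i : ℤ) = ∑ i ∈ Finset.range l, (g i : ℤ) := by
    intro g hg
    symm
    refine Finset.sum_subset (Finset.range_mono hlN) ?_
    intro i _ hi
    rw [hg i (by simpa using hi)]; rfl
  rw [e f h, e (compP c l f) (by intro i hi; simp [compP, hi])]
  rw [← Finset.sum_range_reflect (fun i => (f i : ℤ)) l]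
  have : (c : ℤ) * l = ∑ i ∈ Finset.range l, (c : ℤ) := by simp [mul_comm]
  rw [this, ← Finset.sum_sub_distrib]
  refine Finset.sum_congr rfl fun i hi => ?_
  have := Finset.mem_range.1 hi
  simp only [compP, if_pos this]
  have := hc (l - 1 - i)
  omega

lemma compC_wtv {c m n lam nu x} (h : Ch m lam nu x) (hl : ∀ i, n ≤ i → lam i = 0)
    (hc : ∀ i, nu i ≤ c) :
    wtv m (n+m) (compC c n m x) = fun k => (c : ℤ) - wtv m (n+m) x k := by
  funext k
  have hk := k.2
  simp only [wtv, RR, Finset.sum_sub_distrib, compC]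
  rw [sum_compP (h.supp hl _) (fun i => (h.le_nu _ i).trans (hc i)) (by omega),
    sum_compP (h.supp hl _) (fun i => (h.le_nu _ i).trans (hc i)) (by omega),
    min_eq_left (by omega), min_eq_left (by omega)]
  push_cast
  ring

lemma sum_comp {c m n lam nu} [Fintype {x // Ch m lam nu x}]
    [Fintype {x // Ch m (compP c n lam) (compP c (n+m) nu) x}]
    (hl : ∀ i, n ≤ i → lam i = 0) (hlc : ∀ i, lam i ≤ c)
    (hv : ∀ i, n + m ≤ i → nu i = 0)
    (hc : ∀ i, nu i ≤ c) (F : (Fin m → ℤ) → ℤ) :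
    ∑ x : {x // Ch m (compP c n lam) (compP c (n+m) nu) x}, F (wtv m (n+m) x.1) =
    ∑ x : {x // Ch m lam nu x}, F (fun k => (c : ℤ) - wtv m (n+m) x.1 k) := by
  have hl' : ∀ i, n ≤ i → compP c n lam i = 0 := by
    intro i hi; simp [compP, hi]
  have hc' : ∀ i, compP c (n+m) nu i ≤ c := by
    intro i; simp only [compP]; split_ifs <;> omega
  symm
  refine Finset.sum_bij' (fun x _ => ⟨compC c n m x.1, compC_ch x.2⟩)
    (fun x _ => ⟨compC c n m x.1, ?_⟩) ?_ ?_ ?_ ?_ ?_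
  · have := compC_ch (c := c) (n := n) x.2
    rwa [compP_compP hl hlc, compP_compP hv hc] at this
  · simp
  · simp
  · intro x _; exact Subtype.ext (compC_compC x.2 hl hc)
  · intro x _; exact Subtype.ext (compC_compC x.2 hl' hc')
  · intro x _
    rw [compC_wtv x.2 hl hc]

open Equiv in
lemma sg_rev {m : ℕ} (v u : Fin m → ℤ) (c : ℤ) :
    sg ((fun k => c - (v ∘ Fin.revPerm) k) + rhov m) ((fun k => c - (u ∘ Fin.revPerm) k) + rhov m) =
      sg (v + rhov m) (u + rhov m) := by
  unfold sg
  rw [← Equiv.sum_comp (MulAut.conj (Fin.revPerm : Perm (Fin m))).toEquiv]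
  refine Finset.sum_congr rfl fun w _ => ?_
  have h1 : Perm.sign ((MulAut.conj (Fin.revPerm : Perm (Fin m))).toEquiv w) = Perm.sign w := by
    simp only [MulEquiv.toEquiv_eq_coe, MulEquiv.coe_toEquiv, MulAut.conj_apply, Perm.sign_mul,
      Perm.sign_inv]
    rw [mul_right_comm, Int.units_mul_self, one_mul]
  rw [h1]
  congr 1
  congr 1
  rw [eq_iff_iff, funext_iff, funext_iff]
  have hinv : (Fin.revPerm : Perm (Fin m))⁻¹ = Fin.revPerm := rfl
  have hr : ∀ t : Fin m, rhov m (Fin.rev t) = -(m - 1 : ℤ) - rhov m t := by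
    intro t
    simp only [rhov, Fin.val_rev]
    have := t.2
    omega
  constructor
  · intro h t
    have := h (Fin.rev t)
    simp [MulAut.conj_apply, hinv, hr] at this ⊢
    linarith
  · intro h t
    have := h (Fin.rev t)
    simp [MulAut.conj_apply, hinv, hr] at this ⊢
    linarith

lemma isPartition_compP {c l : ℕ} {f : ℕ → ℕ} (h : IsPartition f) : IsPartition (compP c l f) := by
  refine ⟨?_, l, ?_⟩
  · intro i j hij
    simp only [compP]
    by_cases hj : j < l
    · rw [if_pos hj, if_pos (by omega)]
      have := h.1 (l - 1 - j) (l - 1 - i) (by omega)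
      omega
    · rw [if_neg hj]; omega
  · intro i hi; simp [compP, hi]

lemma lrc_comp {c m n : ℕ} {lam mu nu : ℕ → ℕ}
    (hm : IsPartition mu) (hv : IsPartition nu)
    (hl : ∀ i, n ≤ i → lam i = 0) (hlc : ∀ i, lam i ≤ c)
    (hmc : ∀ i, mu i ≤ c)
    (hvN : ∀ i, n + m ≤ i → nu i = 0) (hc : ∀ i, nu i ≤ c) :
    Nat.card {x // LRC m (n+m) lam mu nu x} =
      Nat.card {x // LRC m (n+m) (compP c n lam) (compP c m mu) (compP c (n+m) nu) x} := by
  have := ch_finite m (lam := lam) hv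
  have := ch_finite m (lam := compP c n lam) (isPartition_compP (c := c) (l := n+m) hv)
  have := Fintype.ofFinite {x // Ch m lam nu x}
  have := Fintype.ofFinite {x // Ch m (compP c n lam) (compP c (n+m) nu) x}
  have hvN' : ∀ i, n + m ≤ i → compP c (n+m) nu i = 0 := by
    intro i hi
    simp only [compP]; rw [if_neg (by omega)]
  have hz : (Nat.card {x // LRC m (n+m) lam mu nu x} : ℤ) =
      Nat.card {x // LRC m (n+m) (compP c n lam) (compP c m mu) (compP c (n+m) nu) x} := by
    rw [stem hvN hm, stem hvN' (isPartition_compP hm)]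
    rw [sum_comp hl hlc hvN hc
      (fun v => sg (v + rhov m) ((fun k : Fin m => (compP c m mu k : ℤ)) + rhov m))]
    rw [← sum_symm hvN (by omega) Fin.revPerm (fun v => sg ((fun k => (c : ℤ) - v k) + rhov m)
      ((fun k : Fin m => (compP c m mu k : ℤ)) + rhov m))]
    refine Finset.sum_congr rfl fun x _ => ?_
    rw [← sg_rev _ _ c]
    congr 2
    funext k
    have hk := k.2
    simp only [compP, if_pos hk, Function.comp, Fin.revPerm_apply, Fin.val_rev]
    rw [show m - 1 - (k : ℕ) = m - (k + 1) by omega]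
    have := hmc (m - (k+1))
    omega
  exact_mod_cast hz

/-! ### Tableaux versus chains -/

def TXRel (lam nu : ℕ → ℕ) (x T : ℕ → ℕ → ℕ) : Prop :=
  (∀ k i, lam i ≤ x k i ∧ x k i ≤ nu i) ∧ (∀ i j, ¬ InSkew lam nu i j → T i j = 0) ∧
    ∀ i j, InSkew lam nu i j → ∀ k, (T i j ≤ k ↔ j < x k i)

lemma TXRel.uniqT {lam nu x T T'} (h : TXRel lam nu x T) (h' : TXRel lam nu x T') : T = T' := by
  funext i j
  by_cases hs : InSkew lam nu i j
  · have a := fun k => (h.2.2 i j hs k).trans (h'.2.2 i j hs k).symm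
    have := a (T i j)
    have := a (T' i j)
    omega
  · rw [h.2.1 i j hs, h'.2.1 i j hs]

lemma TXRel.uniqX {lam nu x x' T} (h : TXRel lam nu x T) (h' : TXRel lam nu x' T) : x = x' := by
  funext k i
  have a := h.1 k i
  have a' := h'.1 k i
  have key : ∀ j, lam i ≤ j → j < nu i → (j < x k i ↔ j < x' k i) := fun j h1 h2 =>
    (h.2.2 i j ⟨h1, h2⟩ k).symm.trans (h'.2.2 i j ⟨h1, h2⟩ k)
  rcases lt_trichotomy (x k i) (x' k i) with hh | hh | hh
  · have := key (x k i) (by omega) (by omega); omega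
  · exact hh
  · have := key (x' k i) (by omega) (by omega); omega

lemma ncard_rows (a b : ℕ → ℕ) (M : ℕ) (s : Set (ℕ × ℕ))
    (hs : ∀ p : ℕ × ℕ, p ∈ s ↔ p.1 < M ∧ a p.1 ≤ p.2 ∧ p.2 < b p.1) :
    s.ncard = ∑ i ∈ Finset.range M, (b i - a i) := by
  have : s = (fun q : (_ : ℕ) × ℕ => (q.1, q.2)) ''
      (((Finset.range M).sigma fun i => Finset.Ico (a i) (b i) : Finset _) : Set _) := by
    ext ⟨i, j⟩
    rw [hs]
    simp
  rw [this, Set.ncard_image_of_injective, Set.ncard_coe_finset, Finset.card_sigma]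
  · simp
  · rintro ⟨i, j⟩ ⟨i', j'⟩ h
    simp at h
    obtain ⟨rfl, rfl⟩ := h
    rfl

lemma TXRel.cell {lam nu x T} (h : TXRel lam nu x T) (i j k : ℕ) :
    (InSkew lam nu i j ∧ T i j = k + 1) ↔ x k i ≤ j ∧ j < x (k+1) i := by
  constructor
  · rintro ⟨hs, ht⟩
    have a := h.2.2 i j hs k
    have b := h.2.2 i j hs (k+1)
    omega
  · rintro ⟨h1, h2⟩
    have c := h.1 k i
    have d := h.1 (k+1) i
    have hs : InSkew lam nu i j := ⟨by omega, by omega⟩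
    have a := h.2.2 i j hs k
    have b := h.2.2 i j hs (k+1)
    exact ⟨hs, by omega⟩

lemma TXRel.mono {lam nu x T} (h : TXRel lam nu x T) (k i : ℕ) : x k i ≤ x (k+1) i := by
  by_contra hc
  have c := h.1 k i
  have d := h.1 (k+1) i
  have hs : InSkew lam nu i (x (k+1) i) := ⟨by omega, by omega⟩
  have a := h.2.2 _ _ hs k
  have b := h.2.2 _ _ hs (k+1)
  omega

lemma RR_nat {x : ℕ → ℕ → ℕ} (h : ∀ k i, x k i ≤ x (k+1) i) (k M : ℕ) :
    ((∑ i ∈ Finset.range M, (x (k+1) i - x k i) : ℕ) : ℤ) = RR x k M := by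
  unfold RR
  push_cast
  refine Finset.sum_congr rfl fun i _ => ?_
  have := h k i
  omega

lemma TXRel.content {lam nu x T N} (h : TXRel lam nu x T) (hN : ∀ i, N ≤ i → nu i = 0) (k : ℕ) :
    ({p : ℕ × ℕ | InSkew lam nu p.1 p.2 ∧ T p.1 p.2 = k + 1}.ncard : ℤ) = RR x k N := by
  rw [ncard_rows (x k) (x (k+1)) N, RR_nat h.mono]
  intro p
  rw [Set.mem_ofPred_eq, h.cell]
  constructor
  · rintro ⟨a, b⟩
    refine ⟨?_, a, b⟩
    by_contra hc
    have := hN p.1 (by omega)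
    have := h.1 (k+1) p.1
    omega
  · rintro ⟨_, a, b⟩; exact ⟨a, b⟩

lemma TXRel.ballot1 {lam nu x T} (h : TXRel lam nu x T) (k i j : ℕ) (hj : x (k+1) i ≤ j) :
    ({p : ℕ × ℕ | InSkew lam nu p.1 p.2 ∧ T p.1 p.2 = k + 1 ∧ ReadBefore p (i, j)}.ncard : ℤ)
      = RR x k i := by
  rw [ncard_rows (x k) (x (k+1)) i, RR_nat h.mono]
  intro p
  rw [Set.mem_ofPred_eq, ← and_assoc, h.cell]
  constructor
  · rintro ⟨⟨a, b⟩, hr⟩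
    refine ⟨?_, a, b⟩
    rcases hr with hr | ⟨hr, hr2⟩
    · exact hr
    · simp only at hr hr2
      rw [hr] at b
      omega
  · rintro ⟨hr, a, b⟩; exact ⟨⟨a, b⟩, Or.inl hr⟩

lemma TXRel.ballot2 {lam nu x T} (h : TXRel lam nu x T) (k i j : ℕ) (hj : x k i ≤ j)
    (hj2 : j ≤ x (k+1) i) :
    ({p : ℕ × ℕ | InSkew lam nu p.1 p.2 ∧ T p.1 p.2 = k + 1 ∧ ReadBefore p (i, j)}.ncard : ℤ)
      = RR x k i + x (k+1) i - j := by
  rw [ncard_rows (fun r => if r = i then j else x k r) (x (k+1)) (i+1)]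
  · rw [Finset.sum_range_succ]
    push_cast
    have : ∑ r ∈ Finset.range i, ((x (k+1) r - (if r = i then j else x k r) : ℕ) : ℤ)
        = RR x k i := by
      rw [← RR_nat h.mono]
      push_cast
      refine Finset.sum_congr rfl fun r hr => ?_
      have := Finset.mem_range.1 hr
      rw [if_neg (by omega)]
    rw [this, if_pos rfl]
    omega
  · intro p
    rw [Set.mem_ofPred_eq, ← and_assoc, h.cell]
    simp only [ReadBefore]
    by_cases hp : p.1 = i
    · rw [if_pos hp, hp]; omega
    · rw [if_neg hp]; omega

lemma rel_iff {m N : ℕ} {lam mu nu : ℕ → ℕ} {x T : ℕ → ℕ → ℕ}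
    (hl : IsPartition lam) (hm : IsPartition mu) (hv : IsPartition nu)
    (hmm : ∀ i, m ≤ i → mu i = 0) (hN : ∀ i, N ≤ i → nu i = 0)
    (h : TXRel lam nu x T) : IsLRTableau lam mu nu T ↔ LRC m N lam mu nu x := by
  constructor
  · rintro ⟨-, -, -, hle, h0, h1, hrow, hcol, hcont, hbal⟩
    have hwt : ∀ k, RR x k N = mu k := fun k => by rw [← h.content hN, hcont k]
    have hTm : ∀ i j, InSkew lam nu i j → T i j ≤ m := by
      intro i j hs
      by_contra hc
      obtain ⟨k, hk⟩ : ∃ k, T i j = k + 1 := ⟨T i j - 1, by omega⟩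
      have hz := hwt k
      rw [hmm k (by omega)] at hz
      have hc := (h.cell i j k).1 ⟨hs, hk⟩
      have hi : i < N := by
        by_contra hc
        have := hN i (by omega)
        have := hs.2
        omega
      have hle : (x (k+1) i : ℤ) - x k i ≤ RR x k N := by
        unfold RR
        refine Finset.single_le_sum (f := fun r => (x (k+1) r : ℤ) - x k r) ?_
          (Finset.mem_range.2 hi)
        intro r _
        have := h.mono k r
        omega
      omega
    have hch : Ch m lam nu x := by
      refine ⟨?_, ?_, ?_⟩
      · funext i
        by_contra hc
        have := h.1 0 i
        have hs : InSkew lam nu i (lam i) := ⟨le_rfl, by omega⟩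
        have := h1 _ _ hs
        have := h.2.2 _ _ hs 0
        omega
      · intro k hk
        funext i
        by_contra hc
        have := h.1 k i
        have hs : InSkew lam nu i (x k i) := ⟨by omega, by omega⟩
        have := hTm _ _ hs
        have := h.2.2 _ _ hs k
        omega
      · intro k i
        refine ⟨h.mono k i, ?_⟩
        by_contra hc
        have a := h.1 k i
        have b := h.1 (k+1) (i+1)
        have c := hl.1 i (i+1) (by omega)
        have d := hv.1 i (i+1) (by omega)
        have s1 : InSkew lam nu i (x k i) := ⟨by omega, by omega⟩
        have s2 : InSkew lam nu (i+1) (x k i) := ⟨by omega, by omega⟩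
        have := hcol i (i+1) (x k i) s1 s2 (by omega)
        have := h.2.2 _ _ s1 k
        have := h.2.2 _ _ s2 (k+1)
        omega
    refine ⟨hch, ?_, ?_⟩
    · intro k i
      unfold Viol
      rw [not_lt]
      induction i with
      | zero =>
        by_cases hx : x (k+1) 0 < x (k+1+1) 0
        · obtain ⟨s, t⟩ := (h.cell 0 (x (k+1) 0) (k+1)).2 ⟨le_rfl, hx⟩
          have := hbal k (0, x (k+1) 0) s t
          have a := h.ballot1 k 0 (x (k+1) 0) le_rfl
          have b := h.ballot2 (k+1) 0 (x (k+1) 0) le_rfl hx.le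
          rw [RR_succ]
          simp only [show k + 1 + 1 = k + 2 from rfl] at *
          omega
        · have := h.mono (k+1) 0
          rw [RR_succ, RR_zero, RR_zero]
          omega
      | succ i ih =>
        by_cases hx : x (k+1) (i+1) < x (k+1+1) (i+1)
        · obtain ⟨s, t⟩ := (h.cell (i+1) (x (k+1) (i+1)) (k+1)).2 ⟨le_rfl, hx⟩
          have := hbal k (i+1, x (k+1) (i+1)) s t
          have a := h.ballot1 k (i+1) (x (k+1) (i+1)) le_rfl
          have b := h.ballot2 (k+1) (i+1) (x (k+1) (i+1)) le_rfl hx.le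
          rw [RR_succ _ _ (i+1)]
          simp only [show k + 1 + 1 = k + 2 from rfl] at *
          omega
        · have := h.mono (k+1) (i+1)
          have := hch.RR_mono k (Nat.le_succ i)
          rw [RR_succ _ _ (i+1)]
          simp only [Nat.succ_eq_add_one] at *
          omega
    · funext k
      exact hwt k
  · rintro ⟨hch, hg, hw⟩
    have hanti : ∀ k i i', i ≤ i' → x k i' ≤ x k i := by
      intro k i i' hi
      induction i', hi using Nat.le_induction with
      | base => exact le_rfl
      | succ i' _ ih =>
        exact ((hch.2.2 k (i'+1)).1.trans (hch.2.2 k i').2).trans ih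
    refine ⟨hl, hm, hv, fun i => (h.1 0 i).1.trans (h.1 0 i).2, h.2.1, ?_, ?_, ?_, ?_, ?_⟩
    · intro i j hs
      by_contra hc
      have := h.2.2 i j hs 0
      rw [hch.1] at this
      have := hs.1
      omega
    · intro i j j' hs hs' hj
      have a := h.2.2 i j hs (T i j')
      have b := h.2.2 i j' hs' (T i j')
      omega
    · intro i i' j hs hs' hi
      have b := (h.2.2 i' j hs' (T i' j)).1 le_rfl
      obtain ⟨k, hk⟩ : ∃ k, T i' j = k + 1 := by
        refine ⟨T i' j - 1, ?_⟩
        by_contra hc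
        have h0 : T i' j = 0 := by omega
        rw [h0, hch.1] at b
        have := hs'.1
        omega
      rw [hk] at b ⊢
      obtain ⟨r, rfl⟩ : ∃ r, i' = r + 1 := ⟨i' - 1, by omega⟩
      have := (hch.2.2 k r).2
      have := hanti k i r (by omega)
      have := (h.2.2 i j hs k).2 (by omega)
      omega
    · intro k
      have := h.content hN k
      by_cases hk : k < m
      · have e := congrFun hw ⟨k, hk⟩
        simp only [wtv] at e
        rw [e] at this
        exact_mod_cast this
      · have e : RR x k N = 0 := by
          unfold RR
          rw [hch.2.1 k (by omega), hch.2.1 (k+1) (by omega)]; simp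
        rw [e] at this
        rw [hmm k (by omega)]
        exact_mod_cast this
    · rintro k ⟨i, j⟩ hs ht
      simp only at hs ht
      have c := (h.cell i j (k+1)).1 ⟨hs, ht⟩
      have a := h.ballot1 k i j c.1
      have b := h.ballot2 (k+1) i j c.1 c.2.le
      have := hg k i
      unfold Viol at this
      rw [RR_succ] at this
      simp only [show k + 1 + 1 = k + 2 from rfl] at *
      omega

def toX (lam nu : ℕ → ℕ) (T : ℕ → ℕ → ℕ) : ℕ → ℕ → ℕ := fun k i =>
  lam i + ((Finset.Ico (lam i) (nu i)).filter fun j => T i j ≤ k).card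

def toT (m : ℕ) (lam nu : ℕ → ℕ) (x : ℕ → ℕ → ℕ) : ℕ → ℕ → ℕ := fun i j =>
  if lam i ≤ j ∧ j < nu i then ((Finset.range m).filter fun k => x k i ≤ j).card else 0

lemma rel_toX {lam mu nu T} (h : IsLRTableau lam mu nu T) : TXRel lam nu (toX lam nu T) T := by
  obtain ⟨-, -, -, hle, h0, h1, hrow, -⟩ := h
  refine ⟨?_, h0, ?_⟩
  · intro k i
    unfold toX
    have := Finset.card_filter_le (Finset.Ico (lam i) (nu i)) (fun j => T i j ≤ k)
    rw [Nat.card_Ico] at this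
    have := hle i
    omega
  · intro i j hs k
    unfold toX
    obtain ⟨s1, s2⟩ := hs
    constructor
    · intro ht
      have : Finset.Ico (lam i) (j+1) ⊆ (Finset.Ico (lam i) (nu i)).filter fun j => T i j ≤ k := by
        intro r hr
        rw [Finset.mem_Ico] at hr
        rw [Finset.mem_filter, Finset.mem_Ico]
        have := hrow i r j ⟨by omega, by omega⟩ ⟨s1, s2⟩ (by omega)
        omega
      have := Finset.card_le_card this
      rw [Nat.card_Ico] at this
      omega
    · intro hx
      by_contra hc
      have : ((Finset.Ico (lam i) (nu i)).filter fun j => T i j ≤ k) ⊆ Finset.Ico (lam i) j := by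
        intro r hr
        rw [Finset.mem_filter, Finset.mem_Ico] at hr
        rw [Finset.mem_Ico]
        refine ⟨hr.1.1, ?_⟩
        by_contra hc2
        have := hrow i j r ⟨s1, s2⟩ ⟨by omega, by omega⟩ (by omega)
        omega
      have := Finset.card_le_card this
      rw [Nat.card_Ico] at this
      omega

lemma rel_toT {m lam nu x} (h : Ch m lam nu x) : TXRel lam nu x (toT m lam nu x) := by
  refine ⟨fun k i => ⟨h.lam_le k i, h.le_nu k i⟩, ?_, ?_⟩
  · intro i j hs
    unfold toT
    exact if_neg hs
  · intro i j hs k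
    unfold toT
    rw [if_pos (show lam i ≤ j ∧ j < nu i from hs)]
    constructor
    · intro hc
      by_contra hx
      have hkm : k < m := by
        by_contra hk
        rw [h.2.1 k (by omega)] at hx
        exact hx hs.2
      have : Finset.range (k+1) ⊆ (Finset.range m).filter fun k => x k i ≤ j := by
        intro r hr
        rw [Finset.mem_range] at hr
        rw [Finset.mem_filter, Finset.mem_range]
        have := h.mono (show r ≤ k by omega) i
        omega
      have := Finset.card_le_card this
      rw [Finset.card_range] at this
      omega
    · intro hx
      have : ((Finset.range m).filter fun k => x k i ≤ j) ⊆ Finset.range k := by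
        intro r hr
        rw [Finset.mem_filter] at hr
        rw [Finset.mem_range]
        by_contra hc
        have := h.mono (show k ≤ r by omega) i
        omega
      have := Finset.card_le_card this
      rwa [Finset.card_range] at this

lemma lr_eq {m N : ℕ} {lam mu nu : ℕ → ℕ}
    (hl : IsPartition lam) (hm : IsPartition mu) (hv : IsPartition nu)
    (hmm : ∀ i, m ≤ i → mu i = 0) (hN : ∀ i, N ≤ i → nu i = 0) :
    lrCoeff lam mu nu = Nat.card {x // LRC m N lam mu nu x} := by
  unfold lrCoeff
  refine Nat.card_congr ⟨
    fun T => ⟨toX lam nu T.1, (rel_iff hl hm hv hmm hN (rel_toX T.2)).1 T.2⟩,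
    fun x => ⟨toT m lam nu x.1, (rel_iff hl hm hv hmm hN (rel_toT x.2.1)).2 x.2⟩, ?_, ?_⟩
  · rintro ⟨T, hT⟩
    apply Subtype.ext
    have := (rel_iff hl hm hv hmm hN (rel_toX hT)).1 hT
    exact (rel_toT this.1).uniqT (rel_toX hT)
  · rintro ⟨x, hx⟩
    apply Subtype.ext
    have := (rel_iff hl hm hv hmm hN (rel_toT hx.1)).2 hx
    exact (rel_toX this).uniqX (rel_toT hx.1)

/-- **Lemma (complementation symmetry of LR coefficients).**
If `λ ⊆ ((a+b)^n)`, `μ ⊆ ((a+b)^m)` and `ν ⊆ ((a+b)^{n+m})`, then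
`c^ν_{λ,μ} = c^{ν^{∨[(a+b)^{n+m}]}}_{λ^{∨[(a+b)^n]}, μ^{∨[(a+b)^m]}}`. -/
theorem stmt9 (a b n m : ℕ) (lam mu nu : ℕ → ℕ)
    (hl : IsPartition lam) (hm : IsPartition mu) (hv : IsPartition nu)
    (hl1 : lam 0 ≤ a + b) (hln : ∀ i, n ≤ i → lam i = 0)
    (hm1 : mu 0 ≤ a + b) (hmm : ∀ i, m ≤ i → mu i = 0)
    (hv1 : nu 0 ≤ a + b) (hvnm : ∀ i, n + m ≤ i → nu i = 0) :
    lrCoeff lam mu nu =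
      lrCoeff (compP (a + b) n lam) (compP (a + b) m mu)
        (compP (a + b) (n + m) nu) := by
  have hlc : ∀ i, lam i ≤ a + b := fun i => (hl.1 0 i (Nat.zero_le _)).trans hl1
  have hmc : ∀ i, mu i ≤ a + b := fun i => (hm.1 0 i (Nat.zero_le _)).trans hm1
  have hvc : ∀ i, nu i ≤ a + b := fun i => (hv.1 0 i (Nat.zero_le _)).trans hv1
  rw [lr_eq (m := m) (N := n + m) hl hm hv hmm hvnm,
    lr_eq (m := m) (N := n + m) (isPartition_compP hl) (isPartition_compP hm)
      (isPartition_compP hv)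
      (by intro i hi; simp only [compP]; rw [if_neg (by omega)])
      (by intro i hi; simp only [compP]; rw [if_neg (by omega)])]
  exact lrc_comp hm hv hln hlc hmc hvnm hvc
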